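/- arXiv:2112.06079 — 5 statements merged into one kernel-verified Lean document; each statement's English description precedes it below -/
import Mathlib

section
/- For every c ∈ (0,1], the function F_c is strictly increasing on [0,1]. -/
open Real Set

/-- `Fc c x` is the function `F_c(x)` from the paper. -/
noncomputable def Fc (c x : ℝ) : ℝ :=
  (c * x ^ 2 + (1 - c) * (1 - x) ^ 2 * (c * x / (c + x))) / (c * x + (1 - c) * (1 - x) ^ 2)

theorem stmt_1 (c : ℝ) (hc : c ∈ Set.Ioc (0 : ℝ) 1) :
    StrictMonoOn (Fc c) (Set.Icc (0 : ℝ) 1) := by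
  obtain ⟨hc0, hc1⟩ := hc
  rcases hc1.eq_or_lt with rfl | hc1
  · have key : ∀ x : ℝ, Fc 1 x = x := by
      intro x
      unfold Fc
      by_cases hx : x = 0
      · subst hx; norm_num
      · rw [div_eq_iff (by simpa using hx)]
        ring
    intro x _ y _ hxy
    rw [key, key]; exact hxy
  have hD : ∀ x : ℝ, 0 ≤ x → 0 < c * x + (1 - c) * (1 - x) ^ 2 := by
    intro x hx
    have h1 : 0 < 1 - c := by linarith
    rcases hx.eq_or_lt with rfl | hx
    · simpa using hc1
    · positivity
  have key : ∀ x : ℝ, 0 ≤ x → Fc c x = x -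
      ((1 - c) * (1 - x) ^ 2 / (c * x + (1 - c) * (1 - x) ^ 2)) * (x - c * x / (c + x)) := by
    intro x hx
    have h1 := (hD x hx).ne'
    unfold Fc
    have h2 := div_mul_cancel₀ ((1 - c) * (1 - x) ^ 2) h1
    rw [div_eq_iff h1]
    linear_combination (x - c * x / (c + x)) * h2
  rintro x ⟨hx0, hx1⟩ y ⟨hy0, hy1⟩ hxy
  rw [key x hx0, key y hy0]
  have hv : (1 - c) * (1 - y) ^ 2 / (c * y + (1 - c) * (1 - y) ^ 2) ≤
      (1 - c) * (1 - x) ^ 2 / (c * x + (1 - c) * (1 - x) ^ 2) := by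
    rw [div_le_div_iff₀ (hD y hy0) (hD x hx0)]
    have h2 : (1 - y) ^ 2 * x ≤ (1 - x) ^ 2 * y := by
      have h3 : (1 - y) ^ 2 ≤ (1 - x) ^ 2 := by
        apply pow_le_pow_left₀ <;> linarith
      exact mul_le_mul h3 hxy.le hx0 (sq_nonneg _)
    have h4 : 0 ≤ (1 - c) * c := mul_nonneg (by linarith) hc0.le
    nlinarith [mul_le_mul_of_nonneg_left h2 h4]
  have hv1 : (1 - c) * (1 - x) ^ 2 / (c * x + (1 - c) * (1 - x) ^ 2) ≤ 1 := by
    rw [div_le_one (hD x hx0)]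
    nlinarith [mul_nonneg hc0.le hx0]
  have hv0 : 0 ≤ (1 - c) * (1 - x) ^ 2 / (c * x + (1 - c) * (1 - x) ^ 2) :=
    div_nonneg (mul_nonneg (by linarith) (sq_nonneg _)) (hD x hx0).le
  have hh : c * x / (c + x) < c * y / (c + y) := by
    rw [div_lt_div_iff₀ (by linarith) (by linarith)]
    nlinarith [mul_lt_mul_of_pos_left hxy (mul_pos hc0 hc0)]
  have hg : 0 ≤ y - c * y / (c + y) := by
    rw [sub_nonneg, div_le_iff₀ (by linarith)]
    nlinarith [mul_nonneg hy0 hy0]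
  generalize (1 - c) * (1 - y) ^ 2 / (c * y + (1 - c) * (1 - y) ^ 2) = w at *
  generalize (1 - c) * (1 - x) ^ 2 / (c * x + (1 - c) * (1 - x) ^ 2) = v at *
  generalize c * x / (c + x) = a at *
  generalize c * y / (c + y) = b at *
  have e1 := mul_le_mul_of_nonneg_right hv hg
  rcases hv0.eq_or_lt with h0 | h0
  · subst h0
    linarith
  · have e2 := mul_pos h0 (sub_pos.2 hh)
    have e3 := mul_nonneg (sub_nonneg.2 hv1) (sub_pos.2 hxy).le
    linarith
end

section
/- For every c ∈ (0,1], the function f_c is strictly increasing on [−π/2, π/2], satisfies f_c(−π/2) = −π/2 and f_c(π/2) = π/2, and its one-sided derivatives at the endpoints equal 1: the right derivative of f_c at −π/2 is 1 and the left derivative of f_c at π/2 is 1. The same statements hold for g_c. -/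
open Real Set Filter Topology

/-- `fc c θ = π·F_c(θ/π + 1/2) − π/2`. -/
noncomputable def fc (c θ : ℝ) : ℝ := π * Fc c (θ / π + 1 / 2) - π / 2

/-- `gc c θ = −f_c(−θ)`. -/
noncomputable def gc (c θ : ℝ) : ℝ := -fc c (-θ)

lemma Fc_one (x : ℝ) : Fc 1 x = x := by
  unfold Fc
  rcases eq_or_ne x 0 with rfl | h
  · simp
  · simp only [sub_self, zero_mul, add_zero, one_mul]
    field_simp

lemma Fc_eq {c x : ℝ} (hc : 0 < c) (hc1 : c < 1) (hx : 0 ≤ x) :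
    0 < c * x + (1 - c) * (1 - x) ^ 2 ∧
    Fc c x = c * x / (c + x) + c * x / (c * x + (1 - c) * (1 - x) ^ 2) * (x ^ 2 / (c + x)) := by
  have h1 : 0 < 1 - c := by linarith
  have hD : 0 < c * x + (1 - c) * (1 - x) ^ 2 := by
    rcases hx.eq_or_lt with rfl | h
    · simpa using h1
    · positivity
  refine ⟨hD, ?_⟩
  have h2 : c + x ≠ 0 := by positivity
  have h3 := hD.ne'
  unfold Fc
  field_simp
  ring

lemma Fc_mono {c : ℝ} (hc : 0 < c) (hc1 : c ≤ 1) : StrictMonoOn (Fc c) (Set.Icc 0 1) := by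
  intro x hx y hy hxy
  rcases hc1.eq_or_lt with rfl | hc1
  · simpa [Fc_one] using hxy
  obtain ⟨hx0, hx1⟩ := hx
  obtain ⟨hy0, hy1⟩ := hy
  have h1 : 0 < 1 - c := by linarith
  obtain ⟨hDx, ex⟩ := Fc_eq hc hc1 hx0
  obtain ⟨hDy, ey⟩ := Fc_eq hc hc1 hy0
  rw [ex, ey]
  have hcx : 0 < c + x := by linarith
  have hcy : 0 < c + y := by linarith
  have a1 : c * x / (c + x) < c * y / (c + y) := by
    rw [div_lt_div_iff₀ hcx hcy]
    nlinarith [mul_pos (mul_pos hc hc) (sub_pos.2 hxy)]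
  have a2 : x ^ 2 / (c + x) ≤ y ^ 2 / (c + y) := by
    rw [div_le_div_iff₀ hcx hcy]
    have e : y ^ 2 * (c + x) - x ^ 2 * (c + y) = (y - x) * (c * (x + y) + x * y) := by ring
    have : 0 ≤ (y - x) * (c * (x + y) + x * y) := by
      have := sub_pos.2 hxy
      positivity
    linarith
  have a3 : c * x / (c * x + (1 - c) * (1 - x) ^ 2) ≤ c * y / (c * y + (1 - c) * (1 - y) ^ 2) := by
    rw [div_le_div_iff₀ hDx hDy]
    have e : c * y * (c * x + (1 - c) * (1 - x) ^ 2) - c * x * (c * y + (1 - c) * (1 - y) ^ 2)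
      = c * (1 - c) * ((y - x) * (1 - x * y)) := by ring
    have h5 : 0 ≤ 1 - x * y := by nlinarith
    have : 0 ≤ c * (1 - c) * ((y - x) * (1 - x * y)) := by
      have := sub_pos.2 hxy
      positivity
    linarith
  have a4 := mul_le_mul a3 a2 (by positivity) (by positivity)
  linarith

lemma Fc_deriv {c x : ℝ} (hc : 0 < c) (hc1 : c ≤ 1) (hx : x = 0 ∨ x = 1) :
    HasDerivAt (Fc c) 1 x := by
  rcases hc1.eq_or_lt with rfl | hc1
  · have : Fc 1 = id := funext Fc_one
    rw [this]
    exact hasDerivAt_id x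
  have hx0 : 0 ≤ x := by rcases hx with rfl | rfl <;> norm_num
  have hD := (Fc_eq hc hc1 hx0).1
  have hcx : c + x ≠ 0 := by positivity
  have i := hasDerivAt_id x
  have q : HasDerivAt (fun x : ℝ => (1 - c) * (1 - x) ^ 2) _ x :=
    ((i.const_sub 1).pow 2).const_mul (1 - c)
  have r : HasDerivAt (fun x : ℝ => c * x / (c + x)) _ x :=
    (i.const_mul c).div (i.const_add c) hcx
  have s : HasDerivAt (fun x : ℝ => c * x ^ 2) _ x := (i.pow 2).const_mul c
  have t : HasDerivAt (fun x : ℝ => c * x + (1 - c) * (1 - x) ^ 2) _ x := (i.const_mul c).add q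
  have u : HasDerivAt (Fc c) _ x := (s.add (q.mul r)).div t hD.ne'
  convert u using 1
  have h1 : 1 - c ≠ 0 := by linarith
  rcases hx with rfl | rfl
  · simp
    field_simp
  · have : c + 1 ≠ 0 := by positivity
    simp
    field_simp
    ring

lemma fc_deriv {c θ : ℝ} (hc : 0 < c) (hc1 : c ≤ 1) (hx : θ = -(π / 2) ∨ θ = π / 2) :
    HasDerivAt (fc c) 1 θ := by
  have hpi := Real.pi_pos.ne'
  have h : HasDerivAt (Fc c) 1 (θ / π + 1 / 2) := by
    apply Fc_deriv hc hc1
    rcases hx with rfl | rfl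
    · left; field_simp; norm_num
    · right; field_simp; norm_num
  have k : HasDerivAt (fun t : ℝ => t / π + 1 / 2) (1 / π) θ :=
    ((hasDerivAt_id θ).div_const π).add_const _
  have u : HasDerivAt (fc c) _ θ := ((h.comp θ k).const_mul π).sub_const (π / 2)
  convert u using 1
  field_simp

lemma gc_deriv {c θ : ℝ} (hc : 0 < c) (hc1 : c ≤ 1) (hx : θ = -(π / 2) ∨ θ = π / 2) :
    HasDerivAt (gc c) 1 θ := by
  have h : HasDerivAt (fc c) 1 (-θ) := by
    apply fc_deriv hc hc1
    rcases hx with rfl | rfl <;> simp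
  have u : HasDerivAt (gc c) _ θ := (h.comp θ (hasDerivAt_neg θ)).neg
  convert u using 1
  norm_num

lemma fc_mono {c : ℝ} (hc : 0 < c) (hc1 : c ≤ 1) :
    StrictMonoOn (fc c) (Set.Icc (-(π / 2)) (π / 2)) := by
  have hpi := Real.pi_pos
  have key : ∀ t ∈ Set.Icc (-(π / 2)) (π / 2), t / π + 1 / 2 ∈ Set.Icc (0 : ℝ) 1 := by
    rintro t ⟨h1, h2⟩
    have h3 : -(1 / 2) ≤ t / π := by rw [le_div_iff₀ hpi]; linarith
    have h4 : t / π ≤ 1 / 2 := by rw [div_le_iff₀ hpi]; linarith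
    constructor <;> linarith
  intro x hx y hy hxy
  have hlt : x / π + 1 / 2 < y / π + 1 / 2 := by gcongr
  have h := Fc_mono hc hc1 (key x hx) (key y hy) hlt
  have := mul_lt_mul_of_pos_left h hpi
  unfold fc
  linarith

theorem stmt_7 (c : ℝ) (hc : c ∈ Set.Ioc (0 : ℝ) 1) :
    StrictMonoOn (fc c) (Set.Icc (-(π / 2)) (π / 2)) ∧
      fc c (-(π / 2)) = -(π / 2) ∧ fc c (π / 2) = π / 2 ∧
      HasDerivWithinAt (fc c) 1 (Set.Icc (-(π / 2)) (π / 2)) (-(π / 2)) ∧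
      HasDerivWithinAt (fc c) 1 (Set.Icc (-(π / 2)) (π / 2)) (π / 2) ∧
      StrictMonoOn (gc c) (Set.Icc (-(π / 2)) (π / 2)) ∧
      gc c (-(π / 2)) = -(π / 2) ∧ gc c (π / 2) = π / 2 ∧
      HasDerivWithinAt (gc c) 1 (Set.Icc (-(π / 2)) (π / 2)) (-(π / 2)) ∧
      HasDerivWithinAt (gc c) 1 (Set.Icc (-(π / 2)) (π / 2)) (π / 2) := by
  obtain ⟨hc, hc1⟩ := hc
  have hpi := Real.pi_pos.ne'
  have m := fc_mono hc hc1
  have e1 : fc c (-(π / 2)) = -(π / 2) := by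
    have : -(π / 2) / π + 1 / 2 = 0 := by field_simp; norm_num
    rw [fc, this]; simp [Fc]
  have e2 : fc c (π / 2) = π / 2 := by
    have : π / 2 / π + 1 / 2 = 1 := by field_simp; norm_num
    rw [fc, this]; simp [Fc, hc.ne']; ring
  refine ⟨m, e1, e2, (fc_deriv hc hc1 (.inl rfl)).hasDerivWithinAt,
    (fc_deriv hc hc1 (.inr rfl)).hasDerivWithinAt, ?_, ?_, ?_,
    (gc_deriv hc hc1 (.inl rfl)).hasDerivWithinAt, (gc_deriv hc hc1 (.inr rfl)).hasDerivWithinAt⟩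
  · intro x hx y hy hxy
    have := m (a := -y) ⟨by linarith [hy.2], by linarith [hy.1]⟩
      (b := -x) ⟨by linarith [hx.2], by linarith [hx.1]⟩ (by linarith)
    unfold gc
    linarith
  · simp [gc, e2]
  · simp [gc, e1]
end

section
/- For every c ∈ (0,1), the one-sided second derivatives of f_c at the endpoints satisfy f_c''(π/2−) = −2(1−c)/(π·c·(1+c)) and f_c''(−π/2+) = −2/(π·c); consequently, by the relation g_c(θ) = −f_c(−θ), one has g_c''(π/2−) = 2/(π·c) and g_c''(−π/2+) = 2(1−c)/(π·c·(1+c)). -/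
open Real Set Filter Topology

/-- Numerator of the correction term. -/
noncomputable def auxP (c x : ℝ) : ℝ := (1 - c) * (1 - x) ^ 2 * x ^ 2

/-- Denominator of the correction term. -/
noncomputable def auxQ (c x : ℝ) : ℝ := (c + x) * (c * x + (1 - c) * (1 - x) ^ 2)

/-- Derivative of `auxP`. -/
noncomputable def auxP' (c x : ℝ) : ℝ :=
  (1 - c) * (2 * x - 6 * x ^ 2 + 4 * x ^ 3)

/-- Derivative of `auxQ`. -/
noncomputable def auxQ' (c x : ℝ) : ℝ :=
  (c * x + (1 - c) * (1 - x) ^ 2) + (c + x) * (c - 2 * (1 - c) * (1 - x))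

/-- Derivative of `Fc`. -/
noncomputable def auxD (c x : ℝ) : ℝ :=
  1 - (auxP' c x * auxQ c x - auxP c x * auxQ' c x) / auxQ c x ^ 2

lemma hasDerivAt_auxP (c x : ℝ) : HasDerivAt (auxP c) (auxP' c x) x := by
  have h1 : HasDerivAt (fun y : ℝ => 1 - y) (-1) x := by
    simpa using (hasDerivAt_id x).const_sub 1
  have h := (((h1.pow 2).const_mul (1 - c)).mul ((hasDerivAt_id x).pow 2))
  refine h.congr_deriv ?_
  simp [auxP']; ring

lemma hasDerivAt_auxQ (c x : ℝ) : HasDerivAt (auxQ c) (auxQ' c x) x := by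
  have h1 : HasDerivAt (fun y : ℝ => 1 - y) (-1) x := by
    simpa using (hasDerivAt_id x).const_sub 1
  have h := ((hasDerivAt_id x).const_add c).mul
    (((hasDerivAt_id x).const_mul c).add ((h1.pow 2).const_mul (1 - c)))
  refine h.congr_deriv ?_
  simp only [auxQ', id, Pi.add_apply, Pi.pow_apply]; push_cast; ring

lemma hasDerivAt_auxP' (c x : ℝ) :
    HasDerivAt (auxP' c) ((1 - c) * (2 - 12 * x + 12 * x ^ 2)) x := by
  have h := ((((hasDerivAt_id x).const_mul 2).sub (((hasDerivAt_id x).pow 2).const_mul 6)).add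
    (((hasDerivAt_id x).pow 3).const_mul 4)).const_mul (1 - c)
  refine h.congr_deriv ?_
  simp only [id]; push_cast; ring

lemma differentiable_auxQ' (c : ℝ) : Differentiable ℝ (auxQ' c) := by
  unfold auxQ'; fun_prop

lemma auxB_pos {c x : ℝ} (hc : c ∈ Set.Ioo (0 : ℝ) 1) (hx : x ∈ Set.Icc (0 : ℝ) 1) :
    0 < c * x + (1 - c) * (1 - x) ^ 2 := by
  obtain ⟨h0, h1⟩ := hc
  obtain ⟨hx0, hx1⟩ := hx
  rcases hx0.eq_or_lt with h | h
  · subst h; norm_num; linarith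
  · have : 0 ≤ (1 - c) * (1 - x) ^ 2 := mul_nonneg (by linarith) (sq_nonneg _)
    have := mul_pos h0 h
    linarith

lemma hasDerivAt_Fc {c x : ℝ} (hc : c ∈ Set.Ioo (0 : ℝ) 1) (hx : x ∈ Set.Icc (0 : ℝ) 1) :
    HasDerivAt (Fc c) (auxD c x) x := by
  have hB := auxB_pos hc hx
  have hA : 0 < c + x := by linarith [hc.1, hx.1]
  have hQ : auxQ c x ≠ 0 := (mul_pos hA hB).ne'
  have h := (hasDerivAt_id x).sub ((hasDerivAt_auxP c x).div (hasDerivAt_auxQ c x) hQ)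
  refine h.congr_of_eventuallyEq ?_
  have e1 : ∀ᶠ y in 𝓝 x, c + y ≠ 0 :=
    ContinuousAt.eventually_ne (g := fun y : ℝ => c + y) (by fun_prop) hA.ne'
  have e2 : ∀ᶠ y in 𝓝 x, c * y + (1 - c) * (1 - y) ^ 2 ≠ 0 :=
    ContinuousAt.eventually_ne (g := fun y : ℝ => c * y + (1 - c) * (1 - y) ^ 2)
      (by fun_prop) hB.ne'
  filter_upwards [e1, e2] with y h1 h2
  simp only [Fc, auxP, auxQ, Pi.sub_apply, Pi.div_apply, id]
  field_simp
  ring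

lemma hasDerivAt_auxD {c x : ℝ} (hc : c ∈ Set.Ioo (0 : ℝ) 1) (hx : x ∈ Set.Icc (0 : ℝ) 1)
    (hP : auxP c x = 0) (hP' : auxP' c x = 0) :
    HasDerivAt (auxD c) (-((1 - c) * (2 - 12 * x + 12 * x ^ 2) / auxQ c x)) x := by
  have hB := auxB_pos hc hx
  have hA : 0 < c + x := by linarith [hc.1, hx.1]
  have hQ : auxQ c x ≠ 0 := (mul_pos hA hB).ne'
  have h := ((((hasDerivAt_auxP' c x).mul (hasDerivAt_auxQ c x)).sub
    ((hasDerivAt_auxP c x).mul (differentiable_auxQ' c x).hasDerivAt)).div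
    ((hasDerivAt_auxQ c x).pow 2) (pow_ne_zero 2 hQ)).const_sub 1
  refine h.congr_deriv ?_
  simp [hP, hP']
  field_simp

lemma mem_unit {θ : ℝ} (h : θ ∈ Set.Icc (-(π / 2)) (π / 2)) :
    θ / π + 1 / 2 ∈ Set.Icc (0 : ℝ) 1 := by
  have hp := Real.pi_pos
  have e : θ / π + 1 / 2 = (θ + π / 2) / π := by field_simp
  rw [e]
  exact ⟨div_nonneg (by linarith [h.1]) hp.le, (div_le_one hp).2 (by linarith [h.2])⟩

lemma hasDerivAt_lin (θ : ℝ) : HasDerivAt (fun t : ℝ => t / π + 1 / 2) (1 / π) θ :=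
  ((hasDerivAt_id θ).div_const π).add_const _

lemma hasDerivAt_fc {c θ : ℝ} (hc : c ∈ Set.Ioo (0 : ℝ) 1)
    (h : θ ∈ Set.Icc (-(π / 2)) (π / 2)) :
    HasDerivAt (fc c) (auxD c (θ / π + 1 / 2)) θ := by
  have hp := Real.pi_pos.ne'
  have h1 := (((hasDerivAt_Fc hc (mem_unit h)).comp θ (hasDerivAt_lin θ)).const_mul π).sub_const
    (π / 2)
  refine h1.congr_deriv ?_
  field_simp

lemma neg_mem {θ : ℝ} (h : θ ∈ Set.Icc (-(π / 2)) (π / 2)) :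
    -θ ∈ Set.Icc (-(π / 2)) (π / 2) := ⟨by linarith [h.2], by linarith [h.1]⟩

lemma hasDerivAt_gc {c θ : ℝ} (hc : c ∈ Set.Ioo (0 : ℝ) 1)
    (h : θ ∈ Set.Icc (-(π / 2)) (π / 2)) :
    HasDerivAt (gc c) (auxD c (-θ / π + 1 / 2)) θ := by
  have h1 := ((hasDerivAt_fc hc (neg_mem h)).comp θ (hasDerivAt_neg θ)).neg
  refine h1.congr_deriv ?_
  simp

lemma second_fc {c θ d : ℝ} (hc : c ∈ Set.Ioo (0 : ℝ) 1)
    (h : θ ∈ Set.Icc (-(π / 2)) (π / 2)) (hd : HasDerivAt (auxD c) d (θ / π + 1 / 2)) :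
    HasDerivWithinAt (fun θ => derivWithin (fc c) (Set.Icc (-(π / 2)) (π / 2)) θ)
      (d / π) (Set.Icc (-(π / 2)) (π / 2)) θ := by
  have hu := uniqueDiffOn_Icc (show -(π / 2) < π / 2 by linarith [Real.pi_pos])
  have h1 := (hd.comp θ (hasDerivAt_lin θ)).hasDerivWithinAt (s := Set.Icc (-(π / 2)) (π / 2))
  rw [mul_one_div] at h1
  exact h1.congr_of_mem (fun t ht => (hasDerivAt_fc hc ht).hasDerivWithinAt.derivWithin (hu t ht)) h

lemma second_gc {c θ d : ℝ} (hc : c ∈ Set.Ioo (0 : ℝ) 1)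
    (h : θ ∈ Set.Icc (-(π / 2)) (π / 2)) (hd : HasDerivAt (auxD c) d (-θ / π + 1 / 2)) :
    HasDerivWithinAt (fun θ => derivWithin (gc c) (Set.Icc (-(π / 2)) (π / 2)) θ)
      (-(d / π)) (Set.Icc (-(π / 2)) (π / 2)) θ := by
  have hu := uniqueDiffOn_Icc (show -(π / 2) < π / 2 by linarith [Real.pi_pos])
  have h1 := (hd.comp θ ((hasDerivAt_lin (-θ)).comp θ (hasDerivAt_neg θ))).hasDerivWithinAt
    (s := Set.Icc (-(π / 2)) (π / 2))
  have e : d * (1 / π * -1) = -(d / π) := by ring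
  rw [e] at h1
  exact h1.congr_of_mem (fun t ht => (hasDerivAt_gc hc ht).hasDerivWithinAt.derivWithin (hu t ht)) h

theorem stmt_8 (c : ℝ) (hc : c ∈ Set.Ioo (0 : ℝ) 1) :
    HasDerivWithinAt (fun θ => derivWithin (fc c) (Set.Icc (-(π / 2)) (π / 2)) θ)
        (-(2 * (1 - c) / (π * c * (1 + c)))) (Set.Icc (-(π / 2)) (π / 2)) (π / 2) ∧
      HasDerivWithinAt (fun θ => derivWithin (fc c) (Set.Icc (-(π / 2)) (π / 2)) θ)
        (-(2 / (π * c))) (Set.Icc (-(π / 2)) (π / 2)) (-(π / 2)) ∧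
      HasDerivWithinAt (fun θ => derivWithin (gc c) (Set.Icc (-(π / 2)) (π / 2)) θ)
        (2 / (π * c)) (Set.Icc (-(π / 2)) (π / 2)) (π / 2) ∧
      HasDerivWithinAt (fun θ => derivWithin (gc c) (Set.Icc (-(π / 2)) (π / 2)) θ)
        (2 * (1 - c) / (π * c * (1 + c))) (Set.Icc (-(π / 2)) (π / 2)) (-(π / 2)) := by
  have hp := Real.pi_pos
  have hp0 := hp.ne'
  have hc0 : c ≠ 0 := hc.1.ne'
  have hc1 : 1 - c ≠ 0 := by linarith [hc.2]
  have hc2 : 1 + c ≠ 0 := by linarith [hc.1]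
  have hc3 : c + 1 ≠ 0 := by linarith [hc.1]
  have hr : π / 2 ∈ Set.Icc (-(π / 2)) (π / 2) := ⟨by linarith, le_rfl⟩
  have hl : -(π / 2) ∈ Set.Icc (-(π / 2)) (π / 2) := ⟨le_rfl, by linarith⟩
  have er : π / 2 / π + 1 / 2 = 1 := by field_simp; norm_num
  have el : -(π / 2) / π + 1 / 2 = 0 := by field_simp; norm_num
  have d0 : HasDerivAt (auxD c) (-(2 / c)) 0 := by
    refine (hasDerivAt_auxD hc (x := 0) (by simp) (by simp [auxP]) (by simp [auxP'])).congr_deriv ?_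
    simp [auxQ]; field_simp
  have d1 : HasDerivAt (auxD c) (-(2 * (1 - c) / (c * (1 + c)))) 1 := by
    refine (hasDerivAt_auxD hc (x := 1) (by simp) (by simp [auxP])
      (by norm_num [auxP'])).congr_deriv ?_
    norm_num [auxQ]; field_simp; try ring
  refine ⟨?_, ?_, ?_, ?_⟩
  · refine (second_fc hc hr (by rw [er]; exact d1)).congr_deriv ?_
    field_simp
  · refine (second_fc hc hl (by rw [el]; exact d0)).congr_deriv ?_
    field_simp
  · refine (second_gc hc hr (by rw [el]; exact d0)).congr_deriv ?_
    field_simp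
  · refine (second_gc hc hl (by rw [neg_neg, er]; exact d1)).congr_deriv ?_
    field_simp
end

section
/- For every c ∈ (0,1), the limits lim_{θ→π/2−} cos(f_c(θ))/cos(g_c(θ)) = 1 and lim_{θ→−π/2+} cos(f_c(θ))/cos(g_c(θ)) = 1 hold. -/
open Real Set Filter Topology

lemma Fc_deriv_s11 (c x : ℝ) (h1 : c + x ≠ 0) (h2 : c * x + (1 - c) * (1 - x) ^ 2 ≠ 0) :
    HasDerivAt (Fc c)
      (((c * (2 * x) + ((1 - c) * (2 * (1 - x) * (-1)) * (c * x / (c + x))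
        + (1 - c) * (1 - x) ^ 2 * ((c * (c + x) - c * x) / (c + x) ^ 2)))
        * (c * x + (1 - c) * (1 - x) ^ 2)
        - (c * x ^ 2 + (1 - c) * (1 - x) ^ 2 * (c * x / (c + x)))
          * (c + (1 - c) * (2 * (1 - x) * (-1)))) / (c * x + (1 - c) * (1 - x) ^ 2) ^ 2) x := by
  have hid := hasDerivAt_id' x
  have a1 : HasDerivAt (fun y : ℝ => c * y ^ 2) (c * (2 * x)) x := by
    simpa using (hid.pow 2).const_mul c
  have a2 : HasDerivAt (fun y : ℝ => (1 - c) * (1 - y) ^ 2) ((1 - c) * (2 * (1 - x) * (-1))) x := by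
    simpa using ((hid.const_sub 1).pow 2).const_mul (1 - c)
  have a3 : HasDerivAt (fun y : ℝ => c * y) c x := by
    simpa using hid.const_mul c
  have a4 : HasDerivAt (fun y : ℝ => c * y / (c + y)) ((c * (c + x) - c * x) / (c + x) ^ 2) x := by
    have h := a3.div (hid.const_add c) h1
    rw [mul_one] at h
    exact h
  exact (a1.add (a2.mul a4)).div (a3.add a2) h2

lemma Fc_zero (c : ℝ) (hc : c ∈ Set.Ioo (0 : ℝ) 1) : HasDerivAt (Fc c) 1 0 := by
  have h0 : c ≠ 0 := hc.1.ne'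
  have h1 : 1 - c ≠ 0 := (sub_pos.2 hc.2).ne'
  convert Fc_deriv_s11 c 0 (by simpa using h0) (by simpa using h1) using 1
  simp only [sub_self, sub_zero, mul_zero, zero_mul, add_zero, zero_add, mul_one, one_pow, ne_eq,
    OfNat.ofNat_ne_zero, not_false_eq_true, zero_pow, zero_div]
  field_simp
  try ring

lemma Fc_one_s11 (c : ℝ) (hc : c ∈ Set.Ioo (0 : ℝ) 1) : HasDerivAt (Fc c) 1 1 := by
  have h0 : c ≠ 0 := hc.1.ne'
  have h1 : c + 1 ≠ 0 := (add_pos hc.1 one_pos).ne'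
  convert Fc_deriv_s11 c 1 h1 (by simpa using h0) using 1
  simp only [sub_self, sub_zero, mul_zero, zero_mul, add_zero, zero_add, mul_one, one_pow, ne_eq,
    OfNat.ofNat_ne_zero, not_false_eq_true, zero_pow, zero_div]
  field_simp
  try ring

lemma fc_deriv_s11 (c a x : ℝ) (hx : a / π + 1 / 2 = x) (h : HasDerivAt (Fc c) 1 x) :
    HasDerivAt (fun θ => Real.cos (fc c θ)) (-Real.sin (fc c a)) a := by
  have e : HasDerivAt (fun θ : ℝ => θ / π + 1 / 2) (1 / π) a :=
    ((hasDerivAt_id' a).div_const π).add_const _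
  subst hx
  have := (((h.comp a e).const_mul π).sub_const (π / 2)).cos
  refine HasDerivAt.congr_deriv this ?_
  have := Real.pi_ne_zero
  simp only [fc, Function.comp]
  field_simp

lemma ratio_tendsto (h k : ℝ → ℝ) (a d : ℝ) (hd : d ≠ 0) (hh : HasDerivAt h d a)
    (hk : HasDerivAt k d a) (h0 : h a = 0) (k0 : k a = 0) :
    Tendsto (fun θ => h θ / k θ) (𝓝[≠] a) (𝓝 1) := by
  have := (hasDerivAt_iff_tendsto_slope.1 hh).div (hasDerivAt_iff_tendsto_slope.1 hk) hd
  rw [div_self hd] at this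
  refine this.congr' ?_
  filter_upwards [self_mem_nhdsWithin] with θ hθ
  have : θ - a ≠ 0 := sub_ne_zero.2 hθ
  simp only [Pi.div_apply, slope_def_field, h0, k0, sub_zero]
  field_simp

theorem stmt_11 (c : ℝ) (hc : c ∈ Set.Ioo (0 : ℝ) 1) :
    Tendsto (fun θ : ℝ => Real.cos (fc c θ) / Real.cos (gc c θ)) (𝓝[<] (π / 2)) (𝓝 1) ∧
      Tendsto (fun θ : ℝ => Real.cos (fc c θ) / Real.cos (gc c θ)) (𝓝[>] (-(π / 2))) (𝓝 1) := by
  have hp := Real.pi_ne_zero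
  have h0 : c ≠ 0 := hc.1.ne'
  have x1 : π / 2 / π + 1 / 2 = 1 := by field_simp; norm_num
  have x0 : -(π / 2) / π + 1 / 2 = 0 := by field_simp; norm_num
  have v1 : fc c (π / 2) = π / 2 := by
    rw [fc, x1]; simp [Fc, h0]; ring
  have v0 : fc c (-(π / 2)) = -(π / 2) := by
    rw [fc, x0]; simp [Fc]
  have d1 := fc_deriv_s11 c _ _ x1 (Fc_one_s11 c hc)
  have d0 := fc_deriv_s11 c _ _ x0 (Fc_zero c hc)
  have hg : ∀ θ, Real.cos (gc c θ) = Real.cos (fc c (-θ)) := fun θ => by rw [gc, Real.cos_neg]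
  simp only [hg]
  rw [v1, Real.sin_pi_div_two] at d1
  rw [v0, Real.sin_neg, Real.sin_pi_div_two, neg_neg] at d0
  have e1 : HasDerivAt (fun θ => Real.cos (fc c (-θ))) (-1) (π / 2) := by
    simpa [Function.comp_def] using HasDerivAt.comp (π / 2) d0 (hasDerivAt_neg (π / 2))
  have e0 : HasDerivAt (fun θ => Real.cos (fc c (-θ))) 1 (-(π / 2)) := by
    have d1' : HasDerivAt (fun θ => Real.cos (fc c θ)) (-1) (-(-(π / 2))) := by
      rw [neg_neg]; exact d1
    simpa [Function.comp_def] using HasDerivAt.comp (-(π / 2)) d1' (hasDerivAt_neg (-(π / 2)))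
  constructor
  · exact (ratio_tendsto _ _ _ _ (by norm_num) d1 e1 (by simp [v1]) (by simp [v0])).mono_left
      (nhdsWithin_mono _ fun x hx => ne_of_lt hx)
  · exact (ratio_tendsto _ _ _ _ (by norm_num) d0 e0 (by simp [v0]) (by simp [v1])).mono_left
      (nhdsWithin_mono _ fun x hx => ne_of_gt hx)
end

section
/- Fix an integer n ≥ 2, θ ∈ (−π/2, π/2), and φ ∈ ℝ. Then lim_{c→0+} a_c(θ,φ) = ( (π/2 + θ)⁴·cos²(nφ/2) ) / ( (π/2 + θ)⁴·cos²(nφ/2) + (π/2 − θ)⁴·sin²(nφ/2) ), where the denominator on the right-hand side is strictly positive. -/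
open Real Set Filter Topology

/-- `ac n c θ φ` is the function `a_c(θ,φ)` from the paper. -/
noncomputable def ac (n : ℕ) (c θ φ : ℝ) : ℝ :=
  Real.cos (n * φ / 2) ^ 2 * Real.cos (fc c θ) ^ 2 /
    (Real.cos (n * φ / 2) ^ 2 * Real.cos (fc c θ) ^ 2 +
      Real.sin (n * φ / 2) ^ 2 * Real.cos (gc c θ) ^ 2)

/-- `ρc n c θ φ` is the function `ρ_c(θ,φ)` from the paper. -/
noncomputable def ρc (n : ℕ) (c θ φ : ℝ) : ℝ :=
  ac n c θ φ * Real.sin (fc c θ) + (1 - ac n c θ φ) * Real.sin (gc c θ)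

/-- `cos (f_c θ) = c * H c` with `H c` convergent as `c → 0`. -/
lemma cos_fc_aux (θ : ℝ) (hθ : θ ∈ Set.Ioo (-(π / 2)) (π / 2)) :
    ∃ H : ℝ → ℝ, (∀ c, Real.cos (fc c θ) = c * H c) ∧
      Tendsto H (𝓝[>] 0) (𝓝 (π * (((π / 2 + θ) ^ 2 + (π / 2 - θ) ^ 2) / (π / 2 - θ) ^ 2))) := by
  obtain ⟨h1, h2⟩ := hθ
  have hpi := Real.pi_pos
  set x : ℝ := θ / π + 1 / 2 with hx
  have hxe : x = (π / 2 + θ) / π := by rw [hx]; field_simp; ring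
  have hye : 1 - x = (π / 2 - θ) / π := by rw [hx]; field_simp; ring
  have hx0 : x ≠ 0 := by rw [hxe]; exact (div_pos (by linarith) hpi).ne'
  have hy0 : 1 - x ≠ 0 := by rw [hye]; exact (div_pos (by linarith) hpi).ne'
  let G : ℝ → ℝ := fun c =>
    (x ^ 2 + (1 - c) * (1 - x) ^ 2 * (x / (c + x))) / (c * x + (1 - c) * (1 - x) ^ 2)
  have hFG : ∀ c, Fc c x = c * G c := by
    intro c
    simp only [Fc, G]
    ring
  have hG : ContinuousAt G 0 := by
    apply ContinuousAt.div
    · apply ContinuousAt.add (by fun_prop)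
      apply ContinuousAt.mul (by fun_prop)
      exact ContinuousAt.div (by fun_prop) (by fun_prop) (by simpa using hx0)
    · fun_prop
    · simpa using hy0
  have hG0 : G 0 = ((π / 2 + θ) ^ 2 + (π / 2 - θ) ^ 2) / (π / 2 - θ) ^ 2 := by
    have h3 : π / 2 - θ ≠ 0 := by linarith
    simp only [G]
    rw [zero_add, div_self hx0, hye, hxe]
    field_simp
    ring
  refine ⟨fun c => π * G c * Real.sinc (π * (c * G c)), ?_, ?_⟩
  · intro c
    have : Real.cos (fc c θ) = Real.sin (π * (c * G c)) := by
      rw [fc, ← hx, hFG, Real.cos_sub_pi_div_two]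
    rw [this]
    have key : ∀ y : ℝ, Real.sin y = y * Real.sinc y := by
      intro y
      by_cases h : y = 0
      · simp [h]
      · rw [Real.sinc_of_ne_zero h]
        field_simp
    rw [key]
    ring
  · have hc : ContinuousAt (fun c => π * G c * Real.sinc (π * (c * G c))) 0 := by
      apply ContinuousAt.mul (by fun_prop)
      exact Real.continuous_sinc.continuousAt.comp
        (f := fun c => π * (c * G c)) (by fun_prop)
    have := hc.tendsto
    simp only [zero_mul, mul_zero, Real.sinc_zero, mul_one, hG0] at this
    exact this.mono_left nhdsWithin_le_nhds

theorem stmt_17 (n : ℕ) (hn : 2 ≤ n) (θ : ℝ) (hθ : θ ∈ Set.Ioo (-(π / 2)) (π / 2)) (φ : ℝ) :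
    0 < (π / 2 + θ) ^ 4 * Real.cos (n * φ / 2) ^ 2 +
        (π / 2 - θ) ^ 4 * Real.sin (n * φ / 2) ^ 2 ∧
      Tendsto (fun c : ℝ => ac n c θ φ) (𝓝[>] 0)
        (𝓝 ((π / 2 + θ) ^ 4 * Real.cos (n * φ / 2) ^ 2 /
          ((π / 2 + θ) ^ 4 * Real.cos (n * φ / 2) ^ 2 +
            (π / 2 - θ) ^ 4 * Real.sin (n * φ / 2) ^ 2))) := by
  obtain ⟨h1, h2⟩ := hθ
  have hpi := Real.pi_pos
  obtain ⟨H, hH, hHt⟩ := cos_fc_aux θ ⟨h1, h2⟩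
  obtain ⟨K, hK, hKt⟩ := cos_fc_aux (-θ) ⟨by linarith, by linarith⟩
  have hp : 0 < π / 2 + θ := by linarith
  have hq : 0 < π / 2 - θ := by linarith
  have hpos : 0 < (π / 2 + θ) ^ 4 * Real.cos (n * φ / 2) ^ 2 +
        (π / 2 - θ) ^ 4 * Real.sin (n * φ / 2) ^ 2 := by
    have hcs := Real.sin_sq_add_cos_sq (n * φ / 2)
    rcases (sq_nonneg (Real.cos (n * φ / 2))).eq_or_lt with h | h
    · have : Real.sin (n * φ / 2) ^ 2 = 1 := by linarith
      rw [← h, this]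
      positivity
    · have h4 := mul_pos (pow_pos hp 4) h
      have h5 : 0 ≤ (π / 2 - θ) ^ 4 * Real.sin (n * φ / 2) ^ 2 := by positivity
      linarith
  refine ⟨hpos, ?_⟩
  rw [← sub_eq_add_neg, sub_neg_eq_add] at hKt
  have hac : ∀ᶠ c in 𝓝[>] (0 : ℝ), Real.cos (n * φ / 2) ^ 2 * H c ^ 2 /
      (Real.cos (n * φ / 2) ^ 2 * H c ^ 2 + Real.sin (n * φ / 2) ^ 2 * K c ^ 2) = ac n c θ φ := by
    filter_upwards [self_mem_nhdsWithin] with c hc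
    have hc0 : c ^ 2 ≠ 0 := pow_ne_zero 2 (ne_of_gt hc)
    rw [ac, gc, Real.cos_neg, hH, hK, ← mul_div_mul_left _ _ hc0]
    congr 1 <;> ring
  refine Tendsto.congr' hac ?_
  generalize Real.cos (n * φ / 2) ^ 2 = C at *
  generalize Real.sin (n * φ / 2) ^ 2 = S at *
  generalize π / 2 + θ = p at *
  generalize π / 2 - θ = q at *
  have hr : 0 < p ^ 2 + q ^ 2 := by positivity
  have e : C * (π * ((p ^ 2 + q ^ 2) / q ^ 2)) ^ 2 + S * (π * ((q ^ 2 + p ^ 2) / p ^ 2)) ^ 2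
      = (π * (p ^ 2 + q ^ 2) / (p ^ 2 * q ^ 2)) ^ 2 * (p ^ 4 * C + q ^ 4 * S) := by
    field_simp
    ring
  have e1 : C * (π * ((p ^ 2 + q ^ 2) / q ^ 2)) ^ 2
      = (π * (p ^ 2 + q ^ 2) / (p ^ 2 * q ^ 2)) ^ 2 * (p ^ 4 * C) := by
    field_simp
  have hk : (π * (p ^ 2 + q ^ 2) / (p ^ 2 * q ^ 2)) ^ 2 ≠ 0 := by positivity
  have hlim := ((hHt.pow 2).const_mul C).div
    (((hHt.pow 2).const_mul C).add ((hKt.pow 2).const_mul S))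
    (by rw [e]; exact mul_ne_zero hk hpos.ne')
  rw [e, e1, mul_div_mul_left _ _ hk] at hlim
  exact hlim
end
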